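/- In the binary-permission heap model, the postcondition W ∗ W ∗ W of the magic-wand example is unsatisfiable: let heaps be h : L → Option V with h₁ ⊕ h₂ defined iff their domains are disjoint (for every l, h₁ l = none or h₂ l = none), yielding the union. Fix distinct locations ℓ₁ ≠ ℓ₂ and assume V is nonempty. Let pt(ℓ) := {h | h ℓ ≠ none} and let W := {h | ∀h', h ⊕ h' is defined → h' ∈ pt(ℓ₁) → (h ⊕ h') ∈ pt(ℓ₁) ∗ pt(ℓ₂)} (the semantic magic wand (ℓ₁ ↦ _) −∗ ((ℓ₁ ↦ _) ∗ (ℓ₂ ↦ _))). Then no heap satisfies W ∗ W ∗ W, i.e. W ∗ W ∗ W = ∅. -/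

import Mathlib

open scoped Classical

noncomputable section

variable {L V : Type*}

/-- Union of partial heaps: take the left entry if defined, otherwise the right. -/
def hunion (h₁ h₂ : L → Option V) : L → Option V :=
  fun l => match h₁ l with
  | some v => some v
  | none => h₂ l

/-- Binary-permission composition: defined iff the domains are disjoint. -/
def bop (h₁ h₂ : L → Option V) : Option (L → Option V) :=
  if ∀ l, h₁ l = none ∨ h₂ l = none then some (hunion h₁ h₂) else none

/-- Separating conjunction of sets of binary heaps. -/
def star (A B : Set (L → Option V)) : Set (L → Option V) :=
  {h | ∃ h₁ ∈ A, ∃ h₂ ∈ B, bop h₁ h₂ = some h}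

/-- The points-to assertion ℓ ↦ _. -/
def pt (ℓ : L) : Set (L → Option V) := {h | h ℓ ≠ none}

/-- The semantic magic wand (ℓ₁ ↦ _) −∗ ((ℓ₁ ↦ _) ∗ (ℓ₂ ↦ _)). -/
def W (ℓ₁ ℓ₂ : L) : Set (L → Option V) :=
  {h | ∀ h' hh', bop h h' = some hh' → h' ∈ pt ℓ₁ → hh' ∈ star (pt ℓ₁) (pt ℓ₂)}

theorem hunion_eq_none_iff (h₁ h₂ : L → Option V) (l : L) :
    hunion h₁ h₂ l = none ↔ h₁ l = none ∧ h₂ l = none := by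
  unfold hunion
  cases h₁ l <;> simp

theorem bop_eq_some_iff (h₁ h₂ h : L → Option V) :
    bop h₁ h₂ = some h ↔ (∀ l, h₁ l = none ∨ h₂ l = none) ∧ hunion h₁ h₂ = h := by
  unfold bop
  split_ifs with hd <;> simp [hd]

/-- Every footprint of the wand owns `ℓ₁` or `ℓ₂`. -/
theorem ne_none_or_ne_none_of_mem_W [Nonempty V] {ℓ₁ ℓ₂ : L} (hne : ℓ₁ ≠ ℓ₂)
    {h : L → Option V} (hW : h ∈ W ℓ₁ ℓ₂) : h ℓ₁ ≠ none ∨ h ℓ₂ ≠ none := by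
  by_contra! hn
  obtain ⟨hn₁, hn₂⟩ := hn
  obtain ⟨v⟩ := ‹Nonempty V›
  let g : L → Option V := fun l => if l = ℓ₁ then some v else none
  have hdisj : ∀ l, h l = none ∨ g l = none := by
    intro l
    by_cases hl : l = ℓ₁
    · exact Or.inl (hl ▸ hn₁)
    · exact Or.inr (if_neg hl)
  have hg : g ∈ pt ℓ₁ := by simp [g, pt]
  obtain ⟨a, -, b, hb, hab⟩ :=
    hW g (hunion h g) ((bop_eq_some_iff _ _ _).2 ⟨hdisj, rfl⟩) hg
  have hunion_ab := ((bop_eq_some_iff _ _ _).1 hab).2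
  have hnone : hunion h g ℓ₂ = none :=
    (hunion_eq_none_iff _ _ _).2 ⟨hn₂, if_neg hne.symm⟩
  rw [← hunion_ab] at hnone
  exact hb ((hunion_eq_none_iff _ _ _).1 hnone).2

/-- Figure 5 of the paper: in the binary-permission heap model, the postcondition
W ∗ W ∗ W is unsatisfiable. -/
theorem stmt15 (L V : Type*) [Nonempty V] (ℓ₁ ℓ₂ : L) (hne : ℓ₁ ≠ ℓ₂) :
    star (W (V := V) ℓ₁ ℓ₂) (star (W ℓ₁ ℓ₂) (W ℓ₁ ℓ₂)) = ∅ := by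
  refine Set.eq_empty_iff_forall_notMem.2 ?_
  rintro h ⟨a, ha, bc, ⟨b, hb, c, hc, hbc⟩, habc⟩
  obtain ⟨hdisj_bc, rfl⟩ := (bop_eq_some_iff _ _ _).1 hbc
  obtain ⟨hdisj_abc, -⟩ := (bop_eq_some_iff _ _ _).1 habc
  simp only [hunion_eq_none_iff] at hdisj_abc
  have ha' := ne_none_or_ne_none_of_mem_W hne ha
  have hb' := ne_none_or_ne_none_of_mem_W hne hb
  have hc' := ne_none_or_ne_none_of_mem_W hne hc
  have h₁ := hdisj_abc ℓ₁
  have h₂ := hdisj_abc ℓ₂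
  have h₃ := hdisj_bc ℓ₁
  have h₄ := hdisj_bc ℓ₂
  tauto

end
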